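/- arXiv:2202.00554 — 6 statements merged into one kernel-verified Lean document; each statement's English description precedes it below -/
import Mathlib

section
/- Let p, q, r be polynomials over a commutative ring satisfying (t+1)·q(t) = t·p(−t−1) + p(0) and (t+1)·r(t) = t·q(−t−1) + q(0). Then r = p. In other words, Aluffi's transformation I is an involution: I(I(p)) = p for every polynomial p. -/
open Polynomial

/-- Aluffi's transformation is an involution: if `q = I(p)` and `r = I(q)`,
encoded by the division-free identities, then `r = p`. -/
theorem aluffi_transform_involutive (R : Type*) [CommRing R] (p q r : R[X])
    (hq : (X + 1) * q = X * p.comp (-X - 1) + C (p.eval 0))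
    (hr : (X + 1) * r = X * q.comp (-X - 1) + C (q.eval 0)) :
    r = p := by
  have eval_zero : q.eval 0 = p.eval 0 := by
    simpa using congrArg (eval 0) hq
  have comp_self : (-X - 1 : R[X]).comp (-X - 1) = X := by
    simp
  have hq_comp := congrArg (fun f : R[X] => f.comp (-X - 1)) hq
  simp only [mul_comp, add_comp, X_comp, one_comp, C_comp, comp_assoc, comp_self,
    comp_X] at hq_comp
  have monic : (X + 1 : R[X]).Monic := by
    simpa using monic_X_add_C (1 : R)
  apply monic.isRegular.left
  change (X + 1) * r = (X + 1) * p
  rw [hr, eval_zero]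
  linear_combination -hq_comp
end

section
/- If polynomials p and q over a commutative ring satisfy (t+1)·q(t) = t·p(−t−1) + p(0), then they also satisfy the reflected identity t·q(−t−1) = (t+1)·p(t) − p(0). -/
open Polynomial

/-- The reflected identity for Aluffi's transformation: if
`(t+1)·q(t) = t·p(−t−1) + p(0)` then `t·q(−t−1) = (t+1)·p(t) − p(0)`. -/
theorem aluffi_transform_reflect (R : Type*) [CommRing R] (p q : R[X])
    (hq : (X + 1) * q = X * p.comp (-X - 1) + C (p.eval 0)) :
    X * q.comp (-X - 1) = (X + 1) * p - C (p.eval 0) := by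
  have h := congrArg (fun r : R[X] => r.comp (-X - 1)) hq
  have hinv : (-X - 1 : R[X]).comp (-X - 1) = X := by
    simp
  simp only [mul_comp, add_comp, X_comp, one_comp, C_comp, comp_assoc, hinv, comp_X] at h
  linear_combination -h
end

section
/- If polynomials p and q over a commutative ring satisfy (t+1)·q(t) = t·p(−t−1) + p(0), then q and p have the same natural degree, and moreover q = 0 if and only if p = 0. In particular, if p is a polynomial then I(p) is a polynomial of the same degree. -/
open Polynomial

/-- The division-free encoding of Aluffi's transformation is symmetric in `p` and `q`. -/
theorem aluffi_relation_symm {R : Type*} [CommRing R] {p q : R[X]}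
    (hq : (X + 1) * q = X * p.comp (-X - 1) + C (p.eval 0)) :
    (X + 1) * p = X * q.comp (-X - 1) + C (q.eval 0) := by
  have h_eval : q.eval 0 = p.eval 0 := by simpa using congrArg (eval 0) hq
  have h_comp : p.comp ((-X - 1 : R[X]).comp (-X - 1)) = p := by simp
  have h := congrArg (fun r : R[X] => r.comp (-X - 1)) hq
  simp only [mul_comp, add_comp, X_comp, one_comp, C_comp, comp_assoc, h_comp] at h
  rw [h_eval]
  linear_combination h

theorem monic_X_add_one {R : Type*} [CommRing R] : (X + 1 : R[X]).Monic := by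
  simpa using monic_X_add_C (1 : R)

theorem aluffi_transform_natDegree_le {R : Type*} [CommRing R] {p q : R[X]}
    (hq : (X + 1) * q = X * p.comp (-X - 1) + C (p.eval 0)) :
    q.natDegree ≤ p.natDegree := by
  rcases eq_or_ne q 0 with rfl | hq0
  · simp
  have : Nontrivial R := nontrivial_iff.mp ⟨q, 0, hq0⟩
  have h_left : ((X + 1) * q).natDegree = 1 + q.natDegree := by
    rw [monic_X_add_one.natDegree_mul' hq0]
    simpa using natDegree_X_add_C (1 : R)
  have h_lin : (-X - 1 : R[X]).natDegree ≤ 1 := by compute_degree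
  have h_comp : (p.comp (-X - 1)).natDegree ≤ p.natDegree :=
    natDegree_comp_le.trans (by simpa using Nat.mul_le_mul_left p.natDegree h_lin)
  have h_right : (X * p.comp (-X - 1) + C (p.eval 0)).natDegree ≤ 1 + p.natDegree := by
    rw [natDegree_add_C]
    exact natDegree_mul_le_of_le natDegree_X_le h_comp
  rw [← hq, h_left] at h_right
  omega

theorem aluffi_transform_eq_zero {R : Type*} [CommRing R] {p q : R[X]}
    (hq : (X + 1) * q = X * p.comp (-X - 1) + C (p.eval 0)) (hp : p = 0) : q = 0 := by
  subst hp
  simpa [monic_X_add_one.mul_right_eq_zero_iff] using hq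

/-- If `q = I(p)` (Aluffi's transformation, encoded division-free), then `q` has the
same natural degree as `p`, and `q = 0` iff `p = 0`. -/
theorem aluffi_transform_natDegree_eq (R : Type*) [CommRing R] (p q : R[X])
    (hq : (X + 1) * q = X * p.comp (-X - 1) + C (p.eval 0)) :
    q.natDegree = p.natDegree ∧ (q = 0 ↔ p = 0) := by
  have hp := aluffi_relation_symm hq
  exact ⟨(aluffi_transform_natDegree_le hq).antisymm (aluffi_transform_natDegree_le hp),
    aluffi_transform_eq_zero hp, aluffi_transform_eq_zero hq⟩
end

section
/- If polynomials p and q over a commutative ring satisfy (t+1)·q(t) = t·p(−t−1) + p(0) and p ≠ 0, then the leading coefficient of q equals (−1)^{deg p} times the leading coefficient of p, where deg p is the natural degree of p. -/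
open Polynomial

/-- If `q = I(p)` (Aluffi's transformation, encoded division-free) and `p ≠ 0`, then
the leading coefficient of `q` is `(−1)^(deg p)` times the leading coefficient of `p`. -/
theorem aluffi_transform_leadingCoeff (R : Type*) [CommRing R] (p q : R[X])
    (hq : (X + 1) * q = X * p.comp (-X - 1) + C (p.eval 0)) (hp : p ≠ 0) :
    q.leadingCoeff = (-1) ^ p.natDegree * p.leadingCoeff := by
  have : Nontrivial R := nontrivial_iff.mp ⟨p, 0, hp⟩
  have hcomp : p.comp (-X - 1) = (taylor (-1) p).comp (-X) := by
    rw [taylor_apply, comp_assoc]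
    simp [sub_eq_add_neg]
  have hne : p.comp (-X - 1) ≠ 0 := by
    rwa [hcomp, Ne, comp_neg_X_eq_zero_iff, taylor_eq_zero]
  have hdeg : degree (C (p.eval 0)) < degree (X * p.comp (-X - 1)) := by
    refine degree_C_le.trans_lt ?_
    rw [← natDegree_pos_iff_degree_pos, natDegree_X_mul hne]
    exact Nat.succ_pos _
  have hmonic : (X + 1 : R[X]).Monic := by simpa using monic_X_add_C (1 : R)
  rw [← leadingCoeff_monic_mul hmonic, hq, leadingCoeff_add_of_degree_lt' hdeg,
    leadingCoeff_monic_mul monic_X, hcomp, comp_neg_X_leadingCoeff_eq, natDegree_taylor,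
    leadingCoeff_taylor]
end

section
/- Let B and S be polynomials in two variables p, u over a commutative ring satisfying (u+p)·S(p,u) = u·B(p,u+p) + p·B(p,0). Then, viewing B and S as polynomials in u with coefficients in the polynomial ring in p, B and S have the same degree in u and the same leading coefficient with respect to u. (This is the algebraic reflection of the fact that the top sectional ML degree s_d and the top ML bidegree b_d both equal the degree of the variety.) -/
open Polynomial

/-- View two-variable polynomials `B(p,u)`, `S(p,u)` as polynomials in `u` with
coefficients in `R[p]` (so `u` is the outer variable `X` and `p` is `C X`). If they
satisfy the Huh–Sturmfels relation `(u+p)·S(p,u) = u·B(p,u+p) + p·B(p,0)`, then `B`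
and `S` have the same degree in `u` and the same leading coefficient in `u`. -/
theorem huhSturmfels_natDegree_leadingCoeff (R : Type*) [CommRing R]
    (B S : Polynomial (Polynomial R))
    (h : (X + C Polynomial.X) * S =
        X * B.comp (X + C Polynomial.X) + C Polynomial.X * C (B.eval 0)) :
    S.natDegree = B.natDegree ∧ S.leadingCoeff = B.leadingCoeff := by
  nontriviality R
  have hm : (X + C (X : R[X])).Monic := monic_X_add_C _
  by_cases hB : B = 0
  · have hS : S = 0 := hm.mul_right_eq_zero_iff.mp (by simpa [hB] using h)
    simp [hB, hS]
  rw [← taylor_apply, ← C_mul] at h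
  have hT : taylor (X : R[X]) B ≠ 0 := by simpa using hB
  have hS : S ≠ 0 := by
    rintro rfl
    have hc := congrArg (fun P => P.coeff (B.natDegree + 1)) h
    simp only [mul_zero, coeff_zero, coeff_add, coeff_X_mul, coeff_C_succ, add_zero,
      coeff_taylor_natDegree] at hc
    exact hB (leadingCoeff_eq_zero.mp hc.symm)
  have hlt : (C (X * B.eval 0) : R[X][X]).natDegree < (X * taylor (X : R[X]) B).natDegree := by
    rw [natDegree_C, natDegree_X_mul hT]
    exact Nat.succ_pos _
  have hdeg := congrArg natDegree h
  have hlead := congrArg leadingCoeff h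
  rw [natDegree_add_eq_left_of_natDegree_lt hlt, hm.natDegree_mul' hS, natDegree_X_add_C,
    natDegree_X_mul hT, natDegree_taylor] at hdeg
  rw [leadingCoeff_add_of_degree_lt' (degree_lt_degree hlt), leadingCoeff_monic_mul hm,
    leadingCoeff_monic_mul monic_X, leadingCoeff_taylor] at hlead
  exact ⟨by omega, hlead⟩
end

section
/- Let n ∈ ℕ and let γ(t), χ(t) be single-variable polynomials of degree at most n over a commutative ring satisfying (t+1)·χ(t) = t·γ(−t−1) + γ(0). Let B(p,u) be the signed homogenization of γ of degree n and let S(p,u) be the unsigned homogenization of χ of degree n. Then (u−p)·B(p,u) = u·S(p,u−p) − p·S(p,0). (This is the second Huh–Sturmfels involution formula of Theorem 1.3 deduced from Aluffi's involution χ = I(γ).) -/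
open MvPolynomial

/-- Evaluating the degree `n` homogenization of `f` at `(p, p * w)` gives `p ^ n * f(w)`. -/
theorem sum_homogenize_eq_pow_mul_aeval {R A : Type*} [CommRing R] [CommRing A] [Algebra R A]
    {n : ℕ} {f : Polynomial R} (hf : f.natDegree ≤ n) (p w : A) :
    ∑ j ∈ Finset.range (n + 1), algebraMap R A (f.coeff j) * (p * w) ^ j * p ^ (n - j) =
      p ^ n * Polynomial.aeval w f := by
  rw [Polynomial.aeval_eq_sum_range' (Nat.lt_succ_of_le hf), Finset.mul_sum]
  refine Finset.sum_congr rfl fun j hj => ?_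
  rw [← Nat.add_sub_of_le (Finset.mem_range_succ_iff.mp hj), Nat.add_sub_cancel_left, pow_add,
    mul_pow, Algebra.smul_def]
  ring

/-- A polynomial ring embeds into an algebra in which a given variable is invertible. -/
theorem exists_injective_algHom_isUnit_X.{u, v} (R : Type u) [CommRing R] {σ : Type v} (i : σ) :
    ∃ (L : Type (max u v)) (_ : CommRing L) (_ : Algebra R L) (ι : MvPolynomial σ R →ₐ[R] L),
      Function.Injective ι ∧ IsUnit (ι (X i)) :=
  ⟨Localization.Away (X i : MvPolynomial σ R), inferInstance, inferInstance,
    IsScalarTower.toAlgHom R _ _,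
    IsLocalization.injective (M := Submonoid.powers (X i : MvPolynomial σ R)) _
      (Submonoid.powers_le.mpr isRegular_X.mem_nonZeroDivisors),
    IsLocalization.Away.algebraMap_isUnit (X i)⟩

/-- The second Huh–Sturmfels involution formula deduced from Aluffi's involution.
Let `γ(t)`, `χ(t)` be single-variable polynomials of degree at most `n` satisfying the
Aluffi relation `(t+1)·χ(t) = t·γ(−t−1) + γ(0)`, let
`B(p,u) = Σ_{j=0}^n (−1)^j γ_j u^j p^{n−j}` be the signed homogenization of `γ`, and let
`S(p,u) = Σ_{j=0}^n χ_j u^j p^{n−j}` be the unsigned homogenization of `χ` (two-variable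
polynomials with variable `0` being `p` and variable `1` being `u`). Then
`(u−p)·B(p,u) = u·S(p,u−p) − p·S(p,0)`. -/
theorem aluffi_implies_huhSturmfels_second (R : Type*) [CommRing R] (n : ℕ)
    (γ χ : Polynomial R) (hγ : γ.natDegree ≤ n) (hχ : χ.natDegree ≤ n)
    (hAluffi : (Polynomial.X + 1) * χ =
        Polynomial.X * γ.comp (-Polynomial.X - 1) + Polynomial.C (γ.eval 0))
    (B S : MvPolynomial (Fin 2) R)
    (hB : B = ∑ j ∈ Finset.range (n + 1),
        C ((-1) ^ j * γ.coeff j) * X 1 ^ j * X 0 ^ (n - j))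
    (hS : S = ∑ j ∈ Finset.range (n + 1),
        C (χ.coeff j) * X 1 ^ j * X 0 ^ (n - j)) :
    (X 1 - X 0) * B =
      X 1 * (bind₁ (fun i : Fin 2 => if i = 1 then X 1 - X 0 else X i)) S
        - X 0 * (bind₁ (fun i : Fin 2 => if i = 1 then 0 else X i)) S := by
  obtain ⟨L, _, _, ι, hι, hX⟩ := exists_injective_algHom_isUnit_X R (0 : Fin 2)
  obtain ⟨q, hq⟩ := hX.exists_right_inv
  have hu : ι (X 1) = ι (X 0) * (q * ι (X 1)) := by rw [← mul_assoc, hq, one_mul]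
  have hC (a : R) : ι (C a) = algebraMap R L a := ι.commutes a
  generalize q * ι (X 1) = w at hu
  have hB' : ι B = ι (X 0) ^ n * Polynomial.aeval (-w) γ := by
    rw [← sum_homogenize_eq_pow_mul_aeval hγ, hB, map_sum]
    refine Finset.sum_congr rfl fun j _ => ?_
    simp only [map_mul, map_pow, hC, hu, mul_neg, map_neg, map_one]
    rw [neg_pow (ι (X 0) * w)]
    ring
  have hS₁ : ι (bind₁ (fun i : Fin 2 => if i = 1 then X 1 - X 0 else X i) S) =
      ι (X 0) ^ n * Polynomial.aeval (w - 1) χ := by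
    rw [← sum_homogenize_eq_pow_mul_aeval hχ, hS, map_sum, map_sum]
    refine Finset.sum_congr rfl fun j _ => ?_
    simp [hC, hu, mul_sub]
  have hS₀ : ι (bind₁ (fun i : Fin 2 => if i = 1 then 0 else X i) S) =
      ι (X 0) ^ n * Polynomial.aeval 0 χ := by
    rw [← sum_homogenize_eq_pow_mul_aeval hχ, hS, map_sum, map_sum]
    refine Finset.sum_congr rfl fun j _ => ?_
    simp [hC]
  have h₁ : w * Polynomial.aeval (w - 1) χ =
      (w - 1) * Polynomial.aeval (-w) γ + algebraMap R L (γ.eval 0) := by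
    simpa [Polynomial.aeval_comp] using congrArg (Polynomial.aeval (w - 1)) hAluffi
  have h₀ : Polynomial.aeval (0 : L) χ = algebraMap R L (γ.eval 0) := by
    simpa using congrArg (Polynomial.aeval (0 : L)) hAluffi
  apply hι
  simp only [map_mul, map_sub, hB', hS₁, hS₀, h₀, hu]
  linear_combination -ι (X 0) ^ (n + 1) * h₁
end
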